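/- (Proposition 4.2) Let b > 0, λ > 0, γ ∈ ℝ, α ∈ (1,2) and C_α > 0, and set κ₀ := 2·(1 + |γ|/λ). Let g be the modified cutoff function with threshold κ₀, let F and V_{c,θ} be built from this g, and let L*_γ be the modified coupling operator. Then for every θ ∈ (0,1) there exist constants c > 0 and η > 0 such that for all y > ỹ ≥ 0 and all x, x̃ ∈ ℝ: (L*_γ V_{c,θ})(y,ỹ,x,x̃) ≤ −η·V_{c,θ}(y − ỹ, |x − x̃|). -/

import Mathlib

open Set MeasureTheory

/-- The Lévy measure of a spectrally positive `α`-stable process: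
`ν_α(dz) = C_α z^{-(1+α)} 1_{z>0} dz`. -/
noncomputable def nuMeasure (Cα α : ℝ) : Measure ℝ :=
  (volume.restrict (Ioi (0 : ℝ))).withDensity fun z => ENNReal.ofReal (Cα * z ^ (-(1 + α)))

/-- The modified cutoff function with threshold `κ₀`: `C²` on `[0,∞)` with
bounded derivatives, nondecreasing, `[0,1]`-valued, vanishing on `[0,1]`,
equal to `(r-1)^{2+δ}` on `(1,3/2)` and equal to `1` on `[κ₀,∞)`. -/
def IsCutoffK (δ κ₀ : ℝ) (g : ℝ → ℝ) : Prop :=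
  ContDiffOn ℝ 2 g (Ici 0) ∧
  (∃ M : ℝ, ∀ r ∈ Ici (0 : ℝ), |g r| ≤ M ∧ |deriv g r| ≤ M ∧ |deriv (deriv g) r| ≤ M) ∧
  MonotoneOn g (Ici 0) ∧
  (∀ r ∈ Ici (0 : ℝ), g r ∈ Icc (0 : ℝ) 1) ∧
  (∀ r : ℝ, 0 ≤ r → r ≤ 1 → g r = 0) ∧
  (∀ r : ℝ, 1 < r → r < 3 / 2 → g r = (r - 1) ^ (2 + δ)) ∧
  (∀ r : ℝ, κ₀ ≤ r → g r = 1)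

/-- `F(s,t) = (1 - g(t/s))·s + g(t/s)·t` for `s ≠ 0`, and `F(0,t) = t`. -/
noncomputable def Fcut (g : ℝ → ℝ) (s t : ℝ) : ℝ :=
  if s = 0 then t else (1 - g (t / s)) * s + g (t / s) * t

/-- `V_{c,θ}(s,t) = c(s + s^θ) + F(s,t)`. -/
noncomputable def Vct (g : ℝ → ℝ) (c θ s t : ℝ) : ℝ :=
  c * (s + s ^ θ) + Fcut g s t

/-- first partial derivative in the first argument -/
noncomputable def D1 (G : ℝ → ℝ → ℝ) (s t : ℝ) : ℝ := deriv (fun a => G a t) s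

/-- first partial derivative in the second argument -/
noncomputable def D2 (G : ℝ → ℝ → ℝ) (s t : ℝ) : ℝ := deriv (fun a => G s a) t

/-- second partial derivative in the first argument -/
noncomputable def D11 (G : ℝ → ℝ → ℝ) (s t : ℝ) : ℝ := deriv (fun a => D1 G a t) s

/-- `σ = (x - x̃)/|x - x̃|` for `x ≠ x̃`, and `σ = 1` for `x = x̃`. -/
noncomputable def sgn' (x xt : ℝ) : ℝ := if x = xt then 1 else (x - xt) / |x - xt|

/-- The modified coupling operator `L*_γ`, corresponding to the two-factor
process whose second component has drift `κ - λ x - γ y`, acting on `G(u,v)`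
with `u = y - ỹ`, `v = |x - x̃|`. -/
noncomputable def LstarGamma (b lam γ Cα α : ℝ) (G : ℝ → ℝ → ℝ) (y yt x xt : ℝ) : ℝ :=
  -b * (y - yt) * D1 G (y - yt) |x - xt|
    + (1 / 2) * (Real.sqrt y + Real.sqrt yt) ^ 2 * D11 G (y - yt) |x - xt|
        * (if 0 < y - yt ∧ y - yt < 1 then 1 else 0)
    + (1 / 2) * (Real.sqrt y - Real.sqrt yt) ^ 2 * D11 G (y - yt) |x - xt|
        * (if 1 ≤ y - yt then 1 else 0)
    - (lam * |x - xt| + γ * (y - yt) * sgn' x xt) * D2 G (y - yt) |x - xt|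
    + (y - yt) * ∫ z, (G (y - yt) |x - xt + z| - G (y - yt) |x - xt|
        - D2 G (y - yt) |x - xt| * sgn' x xt * z) ∂(nuMeasure Cα α)

/-- The cutoff profile `q ↦ g(q)(q-1)` as a `C²` even function `k` on `ℝ` with first and second
derivatives `k1` and `k2` and the bounds used for the coupling operator. -/
structure IsProfile (g : ℝ → ℝ) (C : ℝ) (k k1 k2 : ℝ → ℝ) : Prop where
  hasDerivAt : ∀ q, HasDerivAt k (k1 q) q
  hasDerivAt_deriv : ∀ q, HasDerivAt k1 (k2 q) q
  even : ∀ q, k (-q) = k q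
  odd : ∀ q, k1 (-q) = -k1 q
  eq : ∀ q, 0 ≤ q → k q = g q * (q - 1)
  abs_k1_le : ∀ q, |k1 q| ≤ C
  abs_k2_le : ∀ q, |k2 q| ≤ C
  abs_le : ∀ q, 0 ≤ q → |1 + k q - q * k1 q| ≤ C
  abs_sq_le : ∀ q, 0 ≤ q → |q ^ 2 * k2 q| ≤ C

theorem IsCutoffK.exists_half_profile {δ κ : ℝ} {g : ℝ → ℝ} (hκ : 1 ≤ κ) (hg : IsCutoffK δ κ g) :
    ∃ (C : ℝ) (l l1 l2 : ℝ → ℝ),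
      (∀ q, HasDerivAt l (l1 q) q) ∧ (∀ q, HasDerivAt l1 (l2 q) q) ∧
      (∀ q, q ≤ 0 → l q = 0 ∧ l1 q = 0 ∧ l2 q = 0) ∧
      (∀ q, 0 ≤ q → l q = g q * (q - 1)) ∧
      (∀ q, |l1 q| ≤ C) ∧ (∀ q, |l2 q| ≤ C) ∧
      (∀ q, 0 ≤ q → |1 + l q - q * l1 q| ≤ C) ∧ (∀ q, 0 ≤ q → |q ^ 2 * l2 q| ≤ C) := by
  obtain ⟨hC2, ⟨M, hM⟩, -, -, h0, -, h1⟩ := hg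
  have hC2at : ∀ q, 0 < q → ContDiffAt ℝ 2 g q := fun q hq =>
    hC2.contDiffAt (Ici_mem_nhds hq)
  have hg1 : ∀ q, 0 < q → HasDerivAt g (deriv g q) q := fun q hq =>
    ((hC2at q hq).differentiableAt (by norm_num)).hasDerivAt
  have hg2 : ∀ q, 0 < q → HasDerivAt (deriv g) (deriv (deriv g) q) q := fun q hq => by
    have : ContDiffAt ℝ 1 (deriv g) q := 
      ((hC2at q hq).fderiv_right (m := 1) (by norm_num)).clm_apply contDiffAt_const
    exact (this.differentiableAt (by norm_num)).hasDerivAt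
  have hd0 : ∀ q, 0 < q → q < 1 → deriv g q = 0 := fun q hq hq1 => by
    have : g =ᶠ[nhds q] fun _ => 0 := by
      filter_upwards [Ioo_mem_nhds hq hq1] with a ha using h0 a ha.1.le ha.2.le
    rw [this.deriv_eq]; simp
  have hd1 : ∀ q, κ < q → deriv g q = 0 := fun q hq => by
    have : g =ᶠ[nhds q] fun _ => 1 := by
      filter_upwards [Ioi_mem_nhds hq] with a ha using h1 a (le_of_lt ha)
    rw [this.deriv_eq]; simp
  have hdd1 : ∀ q, κ < q → deriv (deriv g) q = 0 := fun q hq => by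
    have : deriv g =ᶠ[nhds q] fun _ => 0 := by
      filter_upwards [Ioi_mem_nhds hq] with a ha using hd1 a ha
    rw [this.deriv_eq]; simp
  have hM0 : 0 ≤ M := (abs_nonneg _).trans (hM 0 (mem_Ici.2 le_rfl)).1
  have hMκ : 0 ≤ M * κ := by positivity
  let l : ℝ → ℝ := fun q => if q ≤ 1 / 2 then 0 else g q * (q - 1)
  let l1 : ℝ → ℝ := fun q => if q ≤ 1 / 2 then 0 else g q + deriv g q * (q - 1)
  let l2 : ℝ → ℝ := fun q => if q ≤ 1 / 2 then 0 else
    2 * deriv g q + deriv (deriv g) q * (q - 1)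
  have hl : ∀ q, q < 1 → l q = 0 := fun q hq => by
    by_cases h : q ≤ 1 / 2
    · simp only [l, if_pos h]
    · simp only [l, if_neg h, h0 q (by linarith) hq.le, zero_mul]
  have hl1 : ∀ q, q < 1 → l1 q = 0 := fun q hq => by
    by_cases h : q ≤ 1 / 2
    · simp only [l1, if_pos h]
    · simp only [l1, if_neg h, h0 q (by linarith) hq.le, hd0 q (by linarith) hq, zero_mul, add_zero]
  have hA : ∀ q, |l1 q| ≤ 1 + M + M * κ := fun q => by
    by_cases h : q ≤ 1 / 2
    · simp only [l1, if_pos h, abs_zero]; positivity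
    · simp only [l1, if_neg h]
      push Not at h
      have hq0 : 0 < q := by linarith
      rcases lt_or_ge κ q with hq | hq
      · rw [h1 q hq.le, hd1 q hq, zero_mul, add_zero, abs_one]; linarith
      · obtain ⟨ha, hb, -⟩ := hM q hq0.le
        have : |q - 1| ≤ κ := abs_le.2 ⟨by linarith, by linarith⟩
        calc |g q + deriv g q * (q - 1)| ≤ |g q| + |deriv g q| * |q - 1| := by
              rw [← abs_mul]; exact abs_add_le _ _
          _ ≤ M + M * κ := by gcongr
          _ ≤ _ := by linarith
  have hB : ∀ q, |l2 q| ≤ 2 * M + M * κ := fun q => by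
    by_cases h : q ≤ 1 / 2
    · simp only [l2, if_pos h, abs_zero]; positivity
    · simp only [l2, if_neg h]
      push Not at h
      have hq0 : 0 < q := by linarith
      rcases lt_or_ge κ q with hq | hq
      · rw [hdd1 q hq, hd1 q hq]; simp; positivity
      · obtain ⟨-, hb, hc⟩ := hM q hq0.le
        have : |q - 1| ≤ κ := abs_le.2 ⟨by linarith, by linarith⟩
        calc |2 * deriv g q + deriv (deriv g) q * (q - 1)|
            ≤ 2 * |deriv g q| + |deriv (deriv g) q| * |q - 1| := by
              rw [← abs_mul, ← abs_two, ← abs_mul, abs_two]; exact abs_add_le _ _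
          _ ≤ 2 * M + M * κ := by gcongr
  have hD : ∀ q, 0 ≤ q → |q ^ 2 * l2 q| ≤ κ ^ 2 * (2 * M + M * κ) := fun q hq0 => by
    rcases lt_or_ge κ q with hq | hq
    · have : ¬ q ≤ 1 / 2 := by linarith
      simp only [l2, if_neg this]
      rw [hdd1 q hq, hd1 q hq]; simp; positivity
    · rw [abs_mul, abs_of_nonneg (sq_nonneg q)]
      gcongr
      exact hB q
  have hE : ∀ q, 0 ≤ q → |1 + l q - q * l1 q| ≤ 1 + M * κ + κ * (1 + M + M * κ) := fun q hq0 => by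
    rcases lt_or_ge κ q with hq | hq
    · have : ¬ q ≤ 1 / 2 := by linarith
      simp only [l, l1, if_neg this]
      rw [hd1 q hq, h1 q hq.le]; simp; positivity
    · have hlq : |l q| ≤ M * κ := by
        by_cases h : q ≤ 1 / 2
        · simpa only [l, if_pos h, abs_zero] using hMκ
        · simp only [l, if_neg h, abs_mul]
          gcongr
          · exact (hM q hq0).1
          · exact abs_le.2 ⟨by linarith, by linarith⟩
      calc |1 + l q - q * l1 q| ≤ |1 + l q| + |q * l1 q| := abs_sub _ _
        _ ≤ (|1| + |l q|) + |q| * |l1 q| := by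
          rw [abs_mul]; gcongr; exact abs_add_le _ _
        _ ≤ _ := by
          rw [abs_one, abs_of_nonneg hq0]
          gcongr
          exact hA q
  refine ⟨(1 + M * κ + κ * (1 + M + M * κ)) + κ ^ 2 * (2 * M + M * κ) + 2 * M + M * κ, l, l1, l2,
    fun q => ?_, fun q => ?_, fun q hq => ?_, fun q hq => ?_, fun q => (hA q).trans ?_,
    fun q => (hB q).trans ?_, fun q hq => (hE q hq).trans ?_, fun q hq => (hD q hq).trans ?_⟩
  · rcases lt_or_ge q 1 with hq | hq
    · rw [hl1 q hq]
      refine (hasDerivAt_const q (0 : ℝ)).congr_of_eventuallyEq ?_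
      filter_upwards [Iio_mem_nhds hq] with a ha using hl a ha
    · have hq' : ¬ q ≤ 1 / 2 := by linarith
      have h := (hg1 q (by linarith)).mul ((hasDerivAt_id q).sub_const 1)
      refine HasDerivAt.congr_of_eventuallyEq (h.congr_deriv (g' := l1 q) ?_) ?_
      · simp only [l1, if_neg hq', id]; ring
      · filter_upwards [Ioi_mem_nhds (show 1 / 2 < q by linarith)] with a ha
        simp only [l, if_neg (not_le.2 (mem_Ioi.1 ha))]
        simp
  · rcases lt_or_ge q 1 with hq | hq
    · have hl2 : l2 q = 0 := by
        by_cases h : q ≤ 1 / 2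
        · simp only [l2, if_pos h]
        · have hq0 : 0 < q := by linarith
          have : deriv g =ᶠ[nhds q] fun _ => 0 := by
            filter_upwards [Ioo_mem_nhds hq0 hq] with a ha using hd0 a ha.1 ha.2
          simp only [l2, if_neg h, hd0 q hq0 hq, this.deriv_eq]; simp
      rw [hl2]
      refine (hasDerivAt_const q (0 : ℝ)).congr_of_eventuallyEq ?_
      filter_upwards [Iio_mem_nhds hq] with a ha using hl1 a ha
    · have hq' : ¬ q ≤ 1 / 2 := by linarith
      have h := (hg1 q (by linarith)).add
        ((hg2 q (by linarith)).mul ((hasDerivAt_id q).sub_const 1))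
      refine HasDerivAt.congr_of_eventuallyEq (h.congr_deriv (g' := l2 q) ?_) ?_
      · simp only [l2, if_neg hq', id]; ring
      · filter_upwards [Ioi_mem_nhds (show 1 / 2 < q by linarith)] with a ha
        simp only [l1, if_neg (not_le.2 (mem_Ioi.1 ha))]
        simp
  · have h : q ≤ 1 / 2 := by linarith
    simp only [l, l1, l2, if_pos h, and_self]
  · by_cases h : q ≤ 1 / 2
    · simp only [l, if_pos h, h0 q hq (by linarith), zero_mul]
    · simp only [l, if_neg h]
  all_goals nlinarith

theorem IsCutoffK.exists_isProfile {δ κ : ℝ} {g : ℝ → ℝ} (hκ : 1 ≤ κ) (hg : IsCutoffK δ κ g) :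
    ∃ (C : ℝ) (k k1 k2 : ℝ → ℝ), IsProfile g C k k1 k2 := by
  obtain ⟨C, l, l1, l2, h1, h2, h0, heq, hb1, hb2, hb3, hb4⟩ := hg.exists_half_profile hκ
  have hn : ∀ q, 0 ≤ q → l (-q) = 0 ∧ l1 (-q) = 0 ∧ l2 (-q) = 0 := fun q hq => h0 _ (by linarith)
  refine ⟨C, fun q => l q + l (-q), fun q => l1 q - l1 (-q), fun q => l2 q + l2 (-q),
    fun q => ?_, fun q => ?_, fun q => ?_, fun q => ?_, fun q hq => ?_, fun q => ?_, fun q => ?_,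
    fun q hq => ?_, fun q hq => ?_⟩
  · refine ((h1 q).add ((h1 (-q)).comp q (hasDerivAt_neg q))).congr_deriv ?_
    ring
  · refine ((h2 q).sub ((h2 (-q)).comp q (hasDerivAt_neg q))).congr_deriv ?_
    ring
  · simp only [neg_neg]; ring
  · simp only [neg_neg]; ring
  · simp only [(hn q hq).1, heq q hq, add_zero]
  · rcases le_total 0 q with hq | hq
    · simpa only [(hn q hq).2.1, sub_zero] using hb1 q
    · simpa only [(h0 q hq).2.1, zero_sub, abs_neg] using hb1 (-q)
  · rcases le_total 0 q with hq | hq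
    · simpa only [(hn q hq).2.2, add_zero] using hb2 q
    · simpa only [(h0 q hq).2.2, zero_add] using hb2 (-q)
  · simpa only [(hn q hq).1, (hn q hq).2.1, sub_zero, add_zero] using hb3 q hq
  · simpa only [(hn q hq).2.2, add_zero] using hb4 q hq

/-- `z ↦ min(z², z)` is integrable for the Lévy measure. -/
theorem integrable_min_nuMeasure {Cα α : ℝ} (hα : α ∈ Ioo (1 : ℝ) 2) (hCα : 0 < Cα) :
    Integrable (fun z : ℝ => min (z ^ 2) z) (nuMeasure Cα α) := by
  obtain ⟨hα1, hα2⟩ := hα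
  unfold nuMeasure
  rw [integrable_withDensity_iff (by fun_prop) (by simp)]
  change IntegrableOn _ (Ioi 0) volume
  rw [← Ioc_union_Ioi_eq_Ioi (zero_le_one' ℝ)]
  refine IntegrableOn.union ?_ ?_
  · have h : IntegrableOn (fun z : ℝ => Cα * z ^ (1 - α)) (Ioc 0 1) volume :=
      ((intervalIntegrable_iff_integrableOn_Ioc_of_le zero_le_one).1
        (intervalIntegral.intervalIntegrable_rpow' (by linarith))).const_mul Cα
    refine h.congr_fun (fun z hz => ?_) measurableSet_Ioc
    have hz0 : 0 < z := hz.1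
    have hmin : min (z ^ 2) z = z ^ 2 := min_eq_left (by nlinarith [hz.2])
    have e : z ^ (1 - α) = z ^ 2 * z ^ (-(1 + α)) := by
      rw [← Real.rpow_natCast z 2, ← Real.rpow_add hz0]; norm_num; congr 1; ring
    simp only [hmin]
    rw [ENNReal.toReal_ofReal (by positivity), e]; ring
  · have h : IntegrableOn (fun z : ℝ => Cα * z ^ (-α)) (Ioi 1) volume :=
      (integrableOn_Ioi_rpow_of_lt (by linarith) one_pos).const_mul Cα
    refine h.congr_fun (fun z hz => ?_) measurableSet_Ioi
    have hz1 : 1 < z := hz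
    have hz0 : 0 < z := by linarith
    have hmin : min (z ^ 2) z = z := min_eq_right (by nlinarith)
    have e : z ^ (-α) = z * z ^ (-(1 + α)) := by
      rw [← Real.rpow_one_add' hz0.le (by linarith)]; congr 1; ring
    simp only [hmin]
    rw [ENNReal.toReal_ofReal (by positivity), e]; ring

theorem ae_pos_nuMeasure (Cα α : ℝ) : ∀ᵐ z ∂(nuMeasure Cα α), 0 < z :=
  (withDensity_absolutelyContinuous _ _).ae_le (ae_restrict_mem measurableSet_Ioi)

namespace IsProfile

variable {g : ℝ → ℝ} {C : ℝ} {k k1 k2 : ℝ → ℝ}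

theorem nonneg (h : IsProfile g C k k1 k2) : 0 ≤ C :=
  (abs_nonneg _).trans (h.abs_k1_le 0)

theorem k1_zero (h : IsProfile g C k k1 k2) : k1 0 = 0 := by
  have := h.odd 0
  rw [neg_zero] at this
  linarith

theorem Fcut_eq (h : IsProfile g C k k1 k2) {s t : ℝ} (hs : 0 < s) (ht : 0 ≤ t) :
    Fcut g s t = s * (1 + k (t / s)) := by
  rw [Fcut, if_neg hs.ne', h.eq _ (div_nonneg ht hs.le)]
  field_simp
  ring

theorem k_abs (h : IsProfile g C k k1 k2) (w u : ℝ) : k (|w| / u) = k (w / u) := by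
  rcases abs_choice w with hw | hw <;> rw [hw]
  rw [neg_div, h.even]

theorem k1_abs_mul_sgn' (h : IsProfile g C k k1 k2) (x xt u : ℝ) :
    k1 (|x - xt| / u) * sgn' x xt = k1 ((x - xt) / u) := by
  unfold sgn'
  split_ifs with hx
  · simp [hx, h.k1_zero]
  · have hne : x - xt ≠ 0 := sub_ne_zero.2 hx
    rcases lt_or_gt_of_ne hne with hw | hw
    · rw [abs_of_neg hw, neg_div, h.odd, div_neg, div_self hne]; ring
    · rw [abs_of_pos hw, div_self hne, mul_one]

theorem abs_k1_sub_le (h : IsProfile g C k k1 k2) {a b : ℝ} (hab : a < b) :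
    |k1 b - k1 a| ≤ C * (b - a) := by
  obtain ⟨ξ, -, hξ⟩ := exists_hasDerivAt_eq_slope k1 k2 hab
    (fun x _ => (h.hasDerivAt_deriv x).continuousAt.continuousWithinAt)
    (fun x _ => h.hasDerivAt_deriv x)
  have hpos : 0 < b - a := sub_pos.2 hab
  rw [eq_div_iff hpos.ne'] at hξ
  rw [← hξ, abs_mul, abs_of_pos hpos]
  exact mul_le_mul_of_nonneg_right (h.abs_k2_le ξ) hpos.le

theorem taylor_bound (h : IsProfile g C k k1 k2) (q : ℝ) {p : ℝ} (hp : 0 < p) :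
    |k (q + p) - k q - k1 q * p| ≤ C * p ^ 2 ∧ |k (q + p) - k q - k1 q * p| ≤ 2 * C * p := by
  obtain ⟨ξ, hξm, hξ⟩ := exists_hasDerivAt_eq_slope k k1 (lt_add_of_pos_right q hp)
    (fun x _ => (h.hasDerivAt x).continuousAt.continuousWithinAt)
    (fun x _ => h.hasDerivAt x)
  rw [add_sub_cancel_left, eq_div_iff hp.ne'] at hξ
  rw [← hξ, ← sub_mul, abs_mul, abs_of_pos hp]
  constructor
  · have := (h.abs_k1_sub_le hξm.1).trans
      (mul_le_mul_of_nonneg_left (show ξ - q ≤ p by linarith [hξm.2]) h.nonneg)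
    nlinarith
  · refine mul_le_mul_of_nonneg_right ?_ hp.le
    have := abs_sub (k1 ξ) (k1 q)
    linarith [h.abs_k1_le ξ, h.abs_k1_le q]

theorem hasDerivAt_Vct_fst (h : IsProfile g C k k1 k2) (c θ : ℝ) {s t : ℝ} (hs : 0 < s)
    (ht : 0 ≤ t) : HasDerivAt (fun a => Vct g c θ a t)
      (c * (1 + θ * s ^ (θ - 1)) + (1 + k (t / s) - t / s * k1 (t / s))) s := by
  have hr : HasDerivAt (fun a => t / a) (-t / s ^ 2) s := by
    refine ((hasDerivAt_inv hs.ne').const_mul t).congr_deriv ?_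
    field_simp
  have hk : HasDerivAt (fun a => k (t / a)) (k1 (t / s) * (-t / s ^ 2)) s :=
    (h.hasDerivAt _).comp s hr
  have h1 : HasDerivAt (fun a => c * (a + a ^ θ) + a * (1 + k (t / a)))
      (c * (1 + θ * s ^ (θ - 1)) + (1 + k (t / s) - t / s * k1 (t / s))) s := by
    refine ((((hasDerivAt_id s).add (Real.hasDerivAt_rpow_const (Or.inl hs.ne'))).const_mul c).add
      ((hasDerivAt_id s).mul (hk.const_add 1))).congr_deriv ?_
    simp only [id]
    field_simp
    ring
  refine h1.congr_of_eventuallyEq ?_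
  filter_upwards [Ioi_mem_nhds hs] with a ha
  rw [Vct, h.Fcut_eq ha ht]

theorem D1_Vct (h : IsProfile g C k k1 k2) (c θ : ℝ) {s t : ℝ} (hs : 0 < s) (ht : 0 ≤ t) :
    D1 (Vct g c θ) s t
      = c * (1 + θ * s ^ (θ - 1)) + (1 + k (t / s) - t / s * k1 (t / s)) :=
  (h.hasDerivAt_Vct_fst c θ hs ht).deriv

theorem D11_Vct (h : IsProfile g C k k1 k2) (c θ : ℝ) {s t : ℝ} (hs : 0 < s) (ht : 0 ≤ t) :
    D11 (Vct g c θ) s t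
      = c * (θ * ((θ - 1) * s ^ (θ - 2))) + (t / s) ^ 2 * k2 (t / s) / s := by
  have hr : HasDerivAt (fun a => t / a) (-t / s ^ 2) s := by
    refine ((hasDerivAt_inv hs.ne').const_mul t).congr_deriv ?_
    field_simp
  have hk : HasDerivAt (fun a => k (t / a)) (k1 (t / s) * (-t / s ^ 2)) s :=
    (h.hasDerivAt _).comp s hr
  have hk1 : HasDerivAt (fun a => k1 (t / a)) (k2 (t / s) * (-t / s ^ 2)) s :=
    (h.hasDerivAt_deriv _).comp s hr
  have hp : HasDerivAt (fun a : ℝ => a ^ (θ - 1)) ((θ - 1) * s ^ (θ - 2)) s := by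
    have := Real.hasDerivAt_rpow_const (p := θ - 1) (Or.inl hs.ne')
    rwa [show θ - 1 - 1 = θ - 2 by ring] at this
  have h1 : HasDerivAt
      (fun a => c * (1 + θ * a ^ (θ - 1)) + (1 + k (t / a) - t / a * k1 (t / a)))
      (c * (θ * ((θ - 1) * s ^ (θ - 2))) + (t / s) ^ 2 * k2 (t / s) / s) s := by
    refine ((((hp.const_mul θ).const_add 1).const_mul c).add
      ((hk.const_add 1).sub (hr.mul hk1))).congr_deriv ?_
    field_simp
    ring
  refine (h1.congr_of_eventuallyEq ?_).deriv
  filter_upwards [Ioi_mem_nhds hs] with a ha using h.D1_Vct c θ ha ht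

theorem D2_Vct (h : IsProfile g C k k1 k2) (c θ : ℝ) {s t : ℝ} (hs : 0 < s) (ht : 0 ≤ t) :
    D2 (Vct g c θ) s t = k1 (t / s) := by
  have h1 : HasDerivAt (fun a => c * (s + s ^ θ) + s * (1 + k (a / s))) (k1 (t / s)) t := by
    have hk : HasDerivAt (fun a => k (a / s)) (k1 (t / s) * (1 / s)) t :=
      (h.hasDerivAt (t / s)).comp t ((hasDerivAt_id t).div_const s)
    refine (((hk.const_add 1).const_mul s).const_add (c * (s + s ^ θ))).congr_deriv ?_
    field_simp
  rcases ht.eq_or_lt with rfl | ht'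
  · by_cases hd : DifferentiableAt ℝ (fun a => Vct g c θ s a) 0
    · refine (uniqueDiffOn_Ici (0 : ℝ) 0 self_mem_Ici).eq_deriv _
        hd.hasDerivAt.hasDerivWithinAt
        (h1.hasDerivWithinAt.congr_of_mem (fun a ha => ?_) self_mem_Ici)
      rw [Vct, h.Fcut_eq hs ha]
    · rw [D2, deriv_zero_of_not_differentiableAt hd, zero_div, h.k1_zero]
  · refine (h1.congr_of_eventuallyEq ?_).deriv
    filter_upwards [Ioi_mem_nhds ht'] with a ha
    rw [Vct, h.Fcut_eq hs (le_of_lt ha)]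

/-- The jump part of the coupling operator is at most affine in `u`. -/
theorem jump_le (h : IsProfile g C k k1 k2) {Cα α : ℝ} (hα : α ∈ Ioo (1 : ℝ) 2) (hCα : 0 < Cα)
    (c θ : ℝ) {u : ℝ} (hu : 0 < u) (x xt : ℝ) :
    u * ∫ z, (Vct g c θ u |x - xt + z| - Vct g c θ u |x - xt|
        - D2 (Vct g c θ) u |x - xt| * sgn' x xt * z) ∂(nuMeasure Cα α)
      ≤ 2 * C * (∫ z, min (z ^ 2) z ∂(nuMeasure Cα α)) * (1 + u) := by
  have hb : ∀ᵐ z ∂(nuMeasure Cα α), ‖Vct g c θ u |x - xt + z| - Vct g c θ u |x - xt|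
        - D2 (Vct g c θ) u |x - xt| * sgn' x xt * z‖ ≤ 2 * C * (1 + 1 / u) * min (z ^ 2) z := by
    filter_upwards [ae_pos_nuMeasure Cα α] with z hz
    have e : Vct g c θ u |x - xt + z| - Vct g c θ u |x - xt|
        - D2 (Vct g c θ) u |x - xt| * sgn' x xt * z
        = u * (k ((x - xt) / u + z / u) - k ((x - xt) / u) - k1 ((x - xt) / u) * (z / u)) := by
      rw [h.D2_Vct c θ hu (abs_nonneg _), h.k1_abs_mul_sgn', Vct, Vct,
        h.Fcut_eq hu (abs_nonneg _), h.Fcut_eq hu (abs_nonneg _), h.k_abs, h.k_abs, add_div]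
      field_simp
      ring
    obtain ⟨h1, h2⟩ := h.taylor_bound ((x - xt) / u) (div_pos hz hu)
    have hC := h.nonneg
    rw [e, Real.norm_eq_abs, abs_mul, abs_of_pos hu]
    have h1' := mul_le_mul_of_nonneg_left h1 hu.le
    have h2' := mul_le_mul_of_nonneg_left h2 hu.le
    rw [show u * (C * (z / u) ^ 2) = C * (1 / u) * z ^ 2 by field_simp] at h1'
    rw [show u * (2 * C * (z / u)) = 2 * C * z by field_simp] at h2'
    have hi : 0 < 1 / u := by positivity
    rcases min_choice (z ^ 2) z with hm | hm <;> rw [hm]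
    · refine h1'.trans (mul_le_mul_of_nonneg_right ?_ (sq_nonneg z))
      nlinarith [mul_nonneg hC hi.le]
    · refine h2'.trans (mul_le_mul_of_nonneg_right ?_ hz.le)
      nlinarith [mul_nonneg hC hi.le]
  have hint := (le_abs_self _).trans (norm_integral_le_of_norm_le
    ((integrable_min_nuMeasure hα hCα).const_mul (2 * C * (1 + 1 / u))) hb)
  rw [integral_const_mul] at hint
  refine (mul_le_mul_of_nonneg_left hint hu.le).trans_eq ?_
  field_simp
  ring

end IsProfile

/-- The second-order part of the coupling operator, for a second derivative of the form
`-A·u^{θ-2} + e/u`: it beats any constant for `u < 1` and is at most linear for `u ≥ 1`. -/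
theorem diffusion_le {y yt A e C J θ : ℝ} (hyt : 0 ≤ yt) (hy : yt < y) (hθ : θ < 1)
    (hC : 0 ≤ C) (hJ : 0 ≤ J) (hA : C + 2 * J ≤ A) (he : |e| ≤ C) :
    (1 / 2) * (Real.sqrt y + Real.sqrt yt) ^ 2 * (-A * (y - yt) ^ (θ - 2) + e / (y - yt))
        * (if 0 < y - yt ∧ y - yt < 1 then 1 else 0)
      + (1 / 2) * (Real.sqrt y - Real.sqrt yt) ^ 2 * (-A * (y - yt) ^ (θ - 2) + e / (y - yt))
        * (if 1 ≤ y - yt then 1 else 0) ≤ (C + J) * (y - yt) - J := by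
  have hu : 0 < y - yt := sub_pos.2 hy
  have hs1 := Real.sq_sqrt hyt
  have hs2 := Real.sq_sqrt (hyt.trans hy.le)
  have hn1 := Real.sqrt_nonneg yt
  have hn2 := Real.sqrt_le_sqrt hy.le
  set u := y - yt with hudef
  have he' := (abs_le.1 he).2
  have hA0 : 0 ≤ A := by linarith
  rcases lt_or_ge u 1 with h1 | h1
  · rw [if_pos ⟨hu, h1⟩, if_neg (not_le.2 h1), mul_one, mul_zero, add_zero]
    have hpow : 1 / u ≤ u ^ (θ - 2) := by
      rw [one_div, ← Real.rpow_neg_one]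
      exact Real.rpow_le_rpow_of_exponent_ge hu h1.le (by linarith)
    have hbr : -A * u ^ (θ - 2) + e / u ≤ -(2 * J) / u := by
      have h2 : A * (1 / u) ≤ A * u ^ (θ - 2) := mul_le_mul_of_nonneg_left hpow hA0
      have h3 : (C + 2 * J) * (1 / u) ≤ A * (1 / u) :=
        mul_le_mul_of_nonneg_right hA (by positivity)
      have h4 : e * (1 / u) ≤ C * (1 / u) := mul_le_mul_of_nonneg_right he' (by positivity)
      have h5 : e / u = e * (1 / u) := by ring
      have h6 : -(2 * J) / u = -(2 * J) * (1 / u) := by ring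
      rw [h5, h6]; linarith
    have hS : u ≤ (Real.sqrt y + Real.sqrt yt) ^ 2 := by nlinarith
    have hneg : -(2 * J) / u ≤ 0 := div_nonpos_of_nonpos_of_nonneg (by linarith) hu.le
    calc 1 / 2 * (Real.sqrt y + Real.sqrt yt) ^ 2 * (-A * u ^ (θ - 2) + e / u)
        ≤ 1 / 2 * (Real.sqrt y + Real.sqrt yt) ^ 2 * (-(2 * J) / u) :=
          mul_le_mul_of_nonneg_left hbr (by positivity)
      _ ≤ 1 / 2 * u * (-(2 * J) / u) := mul_le_mul_of_nonpos_right (by linarith) hneg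
      _ = -J := by field_simp
      _ ≤ _ := by nlinarith [mul_nonneg (add_nonneg hC hJ) hu.le]
  · rw [if_neg (fun h => absurd h.2 (not_lt.2 h1)), if_pos h1, mul_one, mul_zero, zero_add]
    have hbr : -A * u ^ (θ - 2) + e / u ≤ C / u := by
      have h2 : 0 ≤ A * u ^ (θ - 2) := by positivity
      have h4 : e / u ≤ C / u := div_le_div_of_nonneg_right he' hu.le
      linarith
    have hS : (Real.sqrt y - Real.sqrt yt) ^ 2 ≤ u := by nlinarith
    calc 1 / 2 * (Real.sqrt y - Real.sqrt yt) ^ 2 * (-A * u ^ (θ - 2) + e / u)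
        ≤ 1 / 2 * (Real.sqrt y - Real.sqrt yt) ^ 2 * (C / u) :=
          mul_le_mul_of_nonneg_left hbr (by positivity)
      _ ≤ 1 / 2 * u * (C / u) := by gcongr
      _ = C / 2 := by field_simp
      _ ≤ _ := by nlinarith [mul_nonneg (add_nonneg hC hJ) (sub_nonneg.2 h1)]

/-- Proposition 4.2: with `κ₀ = 2(1 + |γ|/λ)` and `g` a cutoff function with
threshold `κ₀`, for every `θ ∈ (0,1)` there exist `c, η > 0` such that for all
`y > ỹ ≥ 0` and `x, x̃ ∈ ℝ`,
`(L*_γ V_{c,θ})(y,ỹ,x,x̃) ≤ -η V_{c,θ}(y - ỹ, |x - x̃|)`. -/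
theorem stmt17 (b lam γ α Cα δ : ℝ) (hb : 0 < b) (hlam : 0 < lam)
    (hα : α ∈ Ioo (1 : ℝ) 2) (hCα : 0 < Cα) (hδ : 0 < δ)
    (g : ℝ → ℝ) (hg : IsCutoffK δ (2 * (1 + |γ| / lam)) g) :
    ∀ θ ∈ Ioo (0 : ℝ) 1, ∃ c η : ℝ, 0 < c ∧ 0 < η ∧
      ∀ y yt x xt : ℝ, 0 ≤ yt → yt < y →
        LstarGamma b lam γ Cα α (Vct g c θ) y yt x xt
          ≤ -η * Vct g c θ (y - yt) |x - xt| := by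
  rintro θ ⟨hθ0, hθ1⟩
  have hκ : 1 ≤ 2 * (1 + |γ| / lam) := by
    have : 0 ≤ |γ| / lam := by positivity
    linarith
  obtain ⟨C, k, k1, k2, h⟩ := hg.exists_isProfile hκ
  have hC := h.nonneg
  set J := 2 * C * (∫ z, min (z ^ 2) z ∂(nuMeasure Cα α)) with hJdef
  have hJ : 0 ≤ J := by
    refine mul_nonneg (by linarith) (integral_nonneg_of_ae ?_)
    filter_upwards [ae_pos_nuMeasure Cα α] with z hz
    exact le_min (sq_nonneg z) hz.le
  set K := b * C + (C + J) + (lam * C + |γ| * C) + J with hKdef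
  have hK : 0 ≤ K := by positivity
  have hθθ : 0 < θ * (1 - θ) := mul_pos hθ0 (by linarith)
  set c := 1 + (C + 2 * J) / (θ * (1 - θ)) + 2 * K / b with hcdef
  have hc : 0 < c := by positivity
  have hcA : C + 2 * J ≤ c * (θ * (1 - θ)) := by
    rw [← div_le_iff₀ hθθ, hcdef]
    have : 0 ≤ 2 * K / b := by positivity
    linarith
  have hcK : 2 * K ≤ c * b := by
    rw [← div_le_iff₀ hb, hcdef]
    have : 0 ≤ (C + 2 * J) / (θ * (1 - θ)) := by positivity
    linarith
  refine ⟨c, min (min (b / 2) (b * θ)) lam, hc, by positivity, fun y yt x xt hyt hy => ?_⟩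
  have hη1 : min (min (b / 2) (b * θ)) lam ≤ b / 2 := (min_le_left _ _).trans (min_le_left _ _)
  have hη2 : min (min (b / 2) (b * θ)) lam ≤ b * θ := (min_le_left _ _).trans (min_le_right _ _)
  have hη3 : min (min (b / 2) (b * θ)) lam ≤ lam := min_le_right _ _
  set η := min (min (b / 2) (b * θ)) lam
  have hu : 0 < y - yt := sub_pos.2 hy
  have hv : 0 ≤ |x - xt| := abs_nonneg _
  have hr : 0 ≤ |x - xt| / (y - yt) := div_nonneg hv hu.le
  have hjump := h.jump_le hα hCα c θ hu x xt
  rw [← hJdef] at hjump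
  have hdiff := diffusion_le (θ := θ) hyt hy hθ1 hC hJ hcA (h.abs_sq_le _ hr)
  have hdrift := abs_le.1 (h.abs_le _ hr)
  have hF0 : 0 ≤ Fcut g (y - yt) |x - xt| := by
    obtain ⟨hg0, hg1⟩ := hg.2.2.2.1 _ (mem_Ici.2 hr)
    rw [Fcut, if_neg hu.ne']
    have := mul_nonneg (sub_nonneg.2 hg1) hu.le
    have := mul_nonneg hg0 hv
    linarith
  have hγ : -(γ * k1 ((x - xt) / (y - yt))) ≤ |γ| * C :=
    (neg_le_abs _).trans <| by
      rw [abs_mul]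
      exact mul_le_mul_of_nonneg_left (h.abs_k1_le _) (abs_nonneg _)
  have hD11 : D11 (Vct g c θ) (y - yt) |x - xt|
      = -(c * (θ * (1 - θ))) * (y - yt) ^ (θ - 2)
        + (|x - xt| / (y - yt)) ^ 2 * k2 (|x - xt| / (y - yt)) / (y - yt) := by
    rw [h.D11_Vct c θ hu hv]; ring
  have hpow : (y - yt) * (y - yt) ^ (θ - 1) = (y - yt) ^ θ := by
    rw [← Real.rpow_one_add' hu.le (by linarith)]; congr 1; ring
  have hpow0 : 0 ≤ (y - yt) ^ θ := by positivity
  unfold LstarGamma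
  rw [hD11, h.D1_Vct c θ hu hv]
  have hD2 : (lam * |x - xt| + γ * (y - yt) * sgn' x xt) * D2 (Vct g c θ) (y - yt) |x - xt|
      = (y - yt) * (lam * (|x - xt| / (y - yt) * k1 (|x - xt| / (y - yt)))
        + γ * k1 ((x - xt) / (y - yt))) := by
    rw [h.D2_Vct c θ hu hv, ← h.k1_abs_mul_sgn' x xt]
    field_simp
  have hF := h.Fcut_eq hu hv
  rw [hD2]
  generalize (y - yt) * ∫ z, _ ∂(nuMeasure Cα α) = I at hjump ⊢
  rw [Vct]
  set F := Fcut g (y - yt) |x - xt|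
  set u := y - yt
  set r := |x - xt| / u
  have h1 : -b * u * (c * (1 + θ * u ^ (θ - 1)) + (1 + k r - r * k1 r))
      ≤ -(b * c) * u - b * θ * (c * u ^ θ) + b * C * u := by
    have := mul_le_mul_of_nonneg_left hdrift.1 (mul_pos hb hu).le
    rw [← hpow]
    linarith
  have h2 : -(u * (lam * (r * k1 r) + γ * k1 ((x - xt) / u)))
      ≤ -lam * F + (lam * C + |γ| * C) * u := by
    have h3 := mul_le_mul_of_nonneg_left hdrift.2 (mul_pos hlam hu).le
    have h4 := mul_le_mul_of_nonneg_left hγ hu.le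
    rw [hF]
    linarith
  have h5 : η * (c * u) ≤ b / 2 * (c * u) := mul_le_mul_of_nonneg_right hη1 (by positivity)
  have h6 : η * (c * u ^ θ) ≤ b * θ * (c * u ^ θ) :=
    mul_le_mul_of_nonneg_right hη2 (by positivity)
  have h7 : η * F ≤ lam * F := mul_le_mul_of_nonneg_right hη3 hF0
  have h8 := mul_le_mul_of_nonneg_right hcK hu.le
  have h9 : K * u = b * C * u + (C + J) * u + (lam * C + |γ| * C) * u + J * u := by
    rw [hKdef]; ring
  linarith
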